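/- Consider an urn with υ balls of which D are labelled A. Draw all balls one by one without replacement, and let Λ(j) be the number of A-balls among the first j draws. Then for every ε > 0, P( max_{j ≤ υ} |Λ(j) − j·D/υ| > εD ) ≤ 2 exp( − ε²D / (2 + 2ε/3) ). -/

import Mathlib

open scoped Classical

/-- number of `A`-balls among the first `j` draws -/
noncomputable def urnL {υ : ℕ} (A : Finset (Fin υ)) (j : ℕ) (π : Equiv.Perm (Fin υ)) : ℕ :=
  (Finset.univ.filter (fun i : Fin υ => (i : ℕ) < j ∧ π i ∈ A)).card

/-- number of `A`-balls among the remaining draws -/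
noncomputable def urnR {υ : ℕ} (A : Finset (Fin υ)) (j : ℕ) (π : Equiv.Perm (Fin υ)) : ℕ :=
  (Finset.univ.filter (fun i : Fin υ => j ≤ (i : ℕ) ∧ π i ∈ A)).card

/-- number of non-`A`-balls among the remaining draws -/
noncomputable def urnB {υ : ℕ} (A : Finset (Fin υ)) (j : ℕ) (π : Equiv.Perm (Fin υ)) : ℕ :=
  (Finset.univ.filter (fun i : Fin υ => j ≤ (i : ℕ) ∧ π i ∉ A)).card

/-- probability that the last `g` draws avoid `A`, given the first `j` draws -/
noncomputable def urnZ {υ : ℕ} (A : Finset (Fin υ)) (g j : ℕ) (π : Equiv.Perm (Fin υ)) : ℝ :=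
  ((urnB A j π).choose g : ℝ) / ((υ - j).choose g : ℝ)

lemma urnZ_nonneg {υ : ℕ} (A : Finset (Fin υ)) (g j : ℕ) (π : Equiv.Perm (Fin υ)) :
    0 ≤ urnZ A g j π := by unfold urnZ; positivity

lemma urn_card_perm {υ : ℕ} (A : Finset (Fin υ)) (π : Equiv.Perm (Fin υ)) :
    (Finset.univ.filter (fun i : Fin υ => π i ∈ A)).card = A.card := by
  apply Finset.card_bij (fun i _ => π i)
  · intro a ha; simpa using ha
  · intro a _ b _ h; exact π.injective h
  · intro b hb; exact ⟨π.symm b, by simpa using hb, by simp⟩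

lemma urn_L_add_R {υ : ℕ} (A : Finset (Fin υ)) (j : ℕ) (π : Equiv.Perm (Fin υ)) :
    urnL A j π + urnR A j π = A.card := by
  rw [← urn_card_perm A π, urnL, urnR, ← Finset.card_union_of_disjoint]
  · congr 1; ext i
    simp only [Finset.mem_union, Finset.mem_filter, Finset.mem_univ, true_and]
    have := lt_or_ge (i : ℕ) j
    tauto
  · rw [Finset.disjoint_left]; intro i; simp only [Finset.mem_filter]; intro h h'
    have := h.2.1; have := h'.2.1; omega

lemma urn_card_ge (υ j : ℕ) :
    (Finset.univ.filter (fun i : Fin υ => j ≤ (i : ℕ))).card = υ - j := by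
  have h2 := Finset.card_filter_add_card_filter_not (s := (Finset.univ : Finset (Fin υ)))
    (fun i : Fin υ => (i : ℕ) < j)
  simp only [not_lt, Finset.card_univ, Fintype.card_fin] at h2
  simp only [Fin.card_filter_val_lt] at h2
  omega

lemma urn_R_add_B {υ : ℕ} (A : Finset (Fin υ)) (j : ℕ) (π : Equiv.Perm (Fin υ)) :
    urnR A j π + urnB A j π = υ - j := by
  rw [← urn_card_ge υ j, urnB, urnR, ← Finset.card_union_of_disjoint]
  · congr 1; ext i
    simp only [Finset.mem_union, Finset.mem_filter, Finset.mem_univ, true_and]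
    tauto
  · rw [Finset.disjoint_left]; intro i; simp only [Finset.mem_filter]; tauto

lemma urnL_swap {υ : ℕ} (A : Finset (Fin υ)) (j' : ℕ) (a i : Fin υ) (ha : j' ≤ a) (hi : j' ≤ i)
    (π : Equiv.Perm (Fin υ)) : urnL A j' (π * Equiv.swap a i) = urnL A j' π := by
  unfold urnL
  refine congrArg _ (Finset.filter_congr fun x _ => and_congr_right fun hx => ?_)
  rw [Equiv.Perm.mul_apply, Equiv.swap_apply_of_ne_of_ne]
  · rintro rfl; omega
  · rintro rfl; omega

lemma urnB_swap {υ : ℕ} (A : Finset (Fin υ)) (j' : ℕ) (a i : Fin υ) (ha : j' ≤ a) (hi : j' ≤ i)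
    (π : Equiv.Perm (Fin υ)) : urnB A j' (π * Equiv.swap a i) = urnB A j' π := by
  have h1 := urn_R_add_B A j' π
  have h2 := urn_R_add_B A j' (π * Equiv.swap a i)
  have h3 := urn_L_add_R A j' π
  have h4 := urn_L_add_R A j' (π * Equiv.swap a i)
  have h5 := urnL_swap A j' a i ha hi π
  omega

lemma urnB_succ {υ : ℕ} (A : Finset (Fin υ)) (a : Fin υ) (π : Equiv.Perm (Fin υ)) :
    urnB A a π = urnB A (a + 1) π + if π a ∈ A then 0 else 1 := by
  unfold urnB
  split_ifs with h
  · rw [add_zero]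
    congr 1; ext i
    simp only [Finset.mem_filter, Finset.mem_univ, true_and]
    refine and_congr_left fun hi => ?_
    have : (a : ℕ) ≠ i := by
      intro h'; rw [Fin.val_inj] at h'; subst h'; exact hi h
    omega
  · rw [← Finset.card_insert_of_notMem (a := a)]
    · congr 1; ext i
      simp only [Finset.mem_filter, Finset.mem_univ, true_and, Finset.mem_insert]
      by_cases hia : i = a
      · subst hia; simp [h]
      · have : (a : ℕ) ≠ i := by
          intro h'; rw [Fin.val_inj] at h'; exact hia h'.symm
        simp only [hia, false_or]
        refine and_congr_left fun hi => ?_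
        omega
    · simp

lemma urn_choose_step (r b g : ℕ) (h : 1 ≤ r + b) :
    (r : ℝ) * ((b.choose g : ℝ) / ((r + b - 1).choose g : ℝ))
      + b * (((b - 1).choose g : ℝ) / ((r + b - 1).choose g : ℝ))
      ≤ ((r + b : ℕ) : ℝ) * ((b.choose g : ℝ) / ((r + b).choose g : ℝ)) := by
  obtain ⟨m, hm⟩ : ∃ m, r + b = m + 1 := ⟨r + b - 1, by omega⟩
  rw [hm, Nat.add_sub_cancel]
  rcases lt_or_ge m g with hg | hg
  · rw [Nat.choose_eq_zero_of_lt hg]; simp; positivity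
  · have h1 : (0 : ℝ) < (m.choose g : ℝ) := by exact_mod_cast Nat.choose_pos hg
    have h2 : (0 : ℝ) < ((m + 1).choose g : ℝ) := by exact_mod_cast Nat.choose_pos (by omega)
    have e1 : ((m + 1 : ℕ) : ℝ) * (m.choose g : ℝ) = ((m + 1).choose g : ℝ) * ((m : ℝ) + 1 - g) := by
      have := Nat.add_one_mul_choose_eq m g
      have h3 := Nat.choose_succ_right_eq (m + 1) g
      have h4 : (m + 1) * m.choose g = (m + 1).choose g * (m + 1 - g) := by rw [this, h3]
      have h5 : ((m + 1 - g : ℕ) : ℝ) = (m : ℝ) + 1 - g := by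
        rw [Nat.cast_sub (by omega)]; push_cast; ring
      rw [← h5]; exact_mod_cast h4
    have e2 : (b : ℝ) * ((b - 1).choose g : ℝ) = (b.choose g : ℝ) * ((b : ℝ) - g) := by
      rcases b with _ | c
      · rcases g with _ | g <;> simp
      · rcases lt_or_ge (c + 1) g with hc | hc
        · rw [Nat.choose_eq_zero_of_lt hc, Nat.choose_eq_zero_of_lt (by omega)]; simp
        · have := Nat.add_one_mul_choose_eq c g
          have h3 := Nat.choose_succ_right_eq (c + 1) g
          have h4 : (c + 1) * c.choose g = (c + 1).choose g * (c + 1 - g) := by rw [this, h3]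
          rw [← Nat.cast_sub hc, Nat.add_sub_cancel]; exact_mod_cast h4
    have e3 : (r : ℝ) + b = m + 1 := by exact_mod_cast hm
    apply le_of_eq
    rw [← mul_div_assoc, ← mul_div_assoc, ← mul_div_assoc, ← add_div, e2, div_eq_div_iff h1.ne' h2.ne']
    have : (r : ℝ) = m + 1 - b := by linarith
    rw [this]
    linear_combination (-(b.choose g : ℝ)) * e1

/-- one supermartingale step -/
lemma urn_step {υ : ℕ} (A : Finset (Fin υ)) (g : ℕ) (a : Fin υ) (F : Equiv.Perm (Fin υ) → ℝ)
    (hF0 : ∀ π, 0 ≤ F π) (hF : ∀ π (i : Fin υ), a ≤ i → F (π * Equiv.swap a i) = F π) :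
    ∑ π, F π * urnZ A g (a + 1) π ≤ ∑ π, F π * urnZ A g a π := by
  have hn : (0 : ℝ) < ((υ - a : ℕ) : ℝ) := by
    have := a.2
    exact_mod_cast (by omega : 0 < υ - (a : ℕ))
  refine le_of_mul_le_mul_left ?_ hn
  set T := Finset.univ.filter (fun i : Fin υ => (a : ℕ) ≤ i) with hT
  have hTc : T.card = υ - a := urn_card_ge υ a
  have key : ((υ - a : ℕ) : ℝ) * ∑ π, F π * urnZ A g (a + 1) π
      = ∑ π, F π * ∑ i ∈ T, urnZ A g (a + 1) (π * Equiv.swap a i) := by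
    simp_rw [Finset.mul_sum]
    rw [Finset.sum_comm, ← Finset.mul_sum, ← hTc, ← nsmul_eq_mul, ← Finset.sum_const]
    refine Finset.sum_congr rfl fun i hi => ?_
    rw [← Equiv.sum_comp (Equiv.mulRight (Equiv.swap a i))]
    refine Finset.sum_congr rfl fun π _ => ?_
    simp only [Equiv.coe_mulRight]
    rw [hF π i (by simpa [hT] using hi)]
  rw [key, Finset.mul_sum]
  refine Finset.sum_le_sum fun π _ => ?_
  rw [mul_left_comm]
  refine mul_le_mul_of_nonneg_left ?_ (hF0 π)
  have hval : ∀ i ∈ T, urnZ A g (a + 1) (π * Equiv.swap a i) =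
      if π i ∈ A then ((urnB A a π).choose g : ℝ) / ((υ - a - 1).choose g : ℝ)
      else ((urnB A a π - 1).choose g : ℝ) / ((υ - a - 1).choose g : ℝ) := by
    intro i hi
    have hi' : (a : ℕ) ≤ i := by simpa [hT] using hi
    have h1 := urnB_succ A a (π * Equiv.swap a i)
    rw [urnB_swap A a a i le_rfl hi'] at h1
    simp only [Equiv.Perm.mul_apply, Equiv.swap_apply_left] at h1
    unfold urnZ
    rw [Nat.sub_sub]
    split_ifs at h1 ⊢ with h
    · rw [h1, add_zero]
    · rw [h1, Nat.add_sub_cancel]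
  rw [Finset.sum_congr rfl hval, Finset.sum_ite, Finset.sum_const, Finset.sum_const, hT,
    Finset.filter_filter, Finset.filter_filter, nsmul_eq_mul, nsmul_eq_mul]
  have hRB := urn_R_add_B A a π
  have := urn_choose_step (urnR A a π) (urnB A a π) g (by have := a.2; omega)
  rw [hRB] at this
  exact this

/-- crossing before or at time `j` -/
def urnCross {υ : ℕ} (A : Finset (Fin υ)) (t : ℝ) (j : ℕ) (π : Equiv.Perm (Fin υ)) : Prop :=
  ∃ j' ≤ j, t < (urnL A j' π : ℝ) - j' * A.card / υ

lemma urn_optional {υ : ℕ} (A : Finset (Fin υ)) (g : ℕ) (t c : ℝ) (ht : 0 ≤ t)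
    (hc : ∀ j ≤ υ, ∀ π, t < (urnL A j π : ℝ) - j * A.card / υ → c ≤ urnZ A g j π) (j : ℕ)
    (hj : j ≤ υ) :
    ∑ π, (if urnCross A t j π then c else urnZ A g j π) ≤ ∑ π, urnZ A g 0 π := by
  induction j with
  | zero =>
    refine Finset.sum_le_sum fun π _ => ?_
    split_ifs with h
    · obtain ⟨j', hj', h⟩ := h
      obtain rfl : j' = 0 := by omega
      exact hc 0 (by omega) π h
    · exact le_rfl
  | succ j ih =>
    refine le_trans ?_ (ih (by omega))
    have hs := urn_step A g (⟨j, by omega⟩ : Fin υ) (fun π => if urnCross A t j π then 0 else 1)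
      (fun π => by split_ifs <;> norm_num)
      (fun π i hi => by
        have : urnCross A t j (π * Equiv.swap ⟨j, by omega⟩ i) ↔ urnCross A t j π := by
          unfold urnCross
          refine exists_congr fun j' => and_congr_right fun hj' => ?_
          have hi' : j ≤ (i : ℕ) := hi
          rw [urnL_swap A j' _ i (by exact hj') (by omega)]
        simp only [this])
    simp only at hs
    have h1 : ∀ j₂, ∑ π, (if urnCross A t j π then c else urnZ A g j₂ π)
        = ∑ π, (if urnCross A t j π then c else 0)
          + ∑ π, (if urnCross A t j π then (0 : ℝ) else 1) * urnZ A g j₂ π := by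
      intro j₂
      rw [← Finset.sum_add_distrib]
      refine Finset.sum_congr rfl fun π _ => ?_
      split_ifs <;> simp
    calc _ ≤ ∑ π, (if urnCross A t j π then c else urnZ A g (j + 1) π) := by
          refine Finset.sum_le_sum fun π _ => ?_
          by_cases h : urnCross A t j π
          · have h' : urnCross A t (j + 1) π := by
              obtain ⟨j', hj', h⟩ := h; exact ⟨j', by omega, h⟩
            simp [h, h']
          · rw [if_neg h]
            split_ifs with h'
            · obtain ⟨j', hj', h2⟩ := h'
              rcases Nat.lt_or_ge j j' with h3 | h3
              · obtain rfl : j' = j + 1 := by omega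
                exact hc _ hj π h2
              · exact absurd ⟨j', h3, h2⟩ h
            · exact le_rfl
      _ ≤ _ := by
          rw [h1, h1]
          exact add_le_add le_rfl hs

/-- one factor of the numeric estimate -/
lemma urn_factor (υ D n r i ε : ℝ) (hD : 0 < D) (hDυ : D ≤ υ) (hn : n ≤ υ) (hr : 0 ≤ r)
    (hε : 0 < ε) (hcross : r < D * (n / υ - ε)) (hi0 : 0 ≤ i) (hi : i < ε * υ) :
    (υ - D - i) * (n - i) * Real.exp (ε * D / υ) ≤ (n - r - i) * (υ - i) := by
  have hυ : 0 < υ := by linarith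
  have h0 : 0 < n / υ - ε := by
    by_contra h; push Not at h; nlinarith
  obtain ⟨x, rfl⟩ : ∃ x, n = x * υ := ⟨n / υ, by field_simp⟩
  rw [mul_div_cancel_right₀ _ hυ.ne'] at hcross h0
  have hx : x ≤ 1 := by nlinarith
  have hε1 : ε < 1 := by linarith
  obtain ⟨p, rfl⟩ : ∃ p, D = p * υ := ⟨D / υ, by field_simp⟩
  have hp : 0 < p := by by_contra h; push Not at h; nlinarith
  have hp1 : p ≤ 1 := by nlinarith
  have hy : ε * (p * υ) / υ = ε * p := by field_simp
  rw [hy]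
  have hy1 : ε * p < 1 := by nlinarith
  have hexp : Real.exp (ε * p) * (1 - ε * p) ≤ 1 := by
    have := Real.add_one_le_exp (-(ε * p))
    calc _ ≤ Real.exp (ε * p) * Real.exp (-(ε * p)) := by gcongr; linarith
      _ = 1 := by rw [← Real.exp_add]; simp
  have hni : 0 < x * υ - i := by nlinarith
  have hb : 0 < x * υ - r - i := by
    nlinarith [mul_nonneg (mul_nonneg (sub_nonneg.2 hp1) h0.le) hυ.le]
  have hui : 0 < υ - i := by nlinarith
  -- main polynomial inequality
  have h1 : ε * (p * υ) * (x * υ - i) ≤ p * υ * (x * υ - i) - r * (υ - i) := by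
    have h2 : r * (υ - i) ≤ p * υ * (x - ε) * (υ - i) := by gcongr
    have h3 : 0 ≤ p * υ * ((ε * υ - i) * (1 - x)) :=
      mul_nonneg hD.le (mul_nonneg (by linarith) (by linarith))
    nlinarith
  have h4 : (υ - p * υ - i) * (x * υ - i) ≤ (x * υ - r - i) * (υ - i) * (1 - ε * p) := by
    have h5 : ε * p * ((x * υ - r - i) * (υ - i)) ≤ ε * p * ((x * υ - i) * υ) := by
      gcongr <;> linarith
    nlinarith
  calc _ ≤ (x * υ - r - i) * (υ - i) * (1 - ε * p) * Real.exp (ε * p) := by gcongr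
    _ = (x * υ - r - i) * (υ - i) * (Real.exp (ε * p) * (1 - ε * p)) := by ring
    _ ≤ (x * υ - r - i) * (υ - i) * 1 := by gcongr
    _ = _ := by ring

lemma urn_numeric (υ D n r b g : ℕ) (ε : ℝ) (hD : 0 < D) (hDυ : D ≤ υ) (hn : n ≤ υ)
    (hε : 0 < ε) (hb : r + b = n) (hbD : b + D ≤ υ) (hg : g = ⌈ε * υ⌉₊)
    (hcross : (r : ℝ) < D * ((n : ℝ) / υ - ε)) :
    g ≤ b ∧ Real.exp (ε ^ 2 * D) * (((υ - D).choose g : ℝ) / (υ.choose g : ℝ))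
      ≤ (b.choose g : ℝ) / (n.choose g : ℝ) := by
  have hDr : (0 : ℝ) < D := by exact_mod_cast hD
  have hυr : (D : ℝ) ≤ υ := by exact_mod_cast hDυ
  have hυ0 : (0 : ℝ) < υ := by linarith
  have hnr : (n : ℝ) ≤ υ := by exact_mod_cast hn
  have hbr : (b : ℝ) = n - r := by rw [← hb]; push_cast; ring
  have hr0 : (0 : ℝ) ≤ r := by positivity
  have hgb : g ≤ b := by
    rw [hg, Nat.ceil_le]
    have h0 : 0 < (n : ℝ) / υ - ε := by
      by_contra h; push Not at h; nlinarith
    have h1 : (n : ℝ) - ε * υ = υ * ((n : ℝ) / υ - ε) := by field_simp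
    nlinarith
  refine ⟨hgb, ?_⟩
  have hgn : g ≤ n := by omega
  have c1 : (0 : ℝ) < (υ.choose g : ℝ) := by exact_mod_cast Nat.choose_pos (by omega)
  have c2 : (0 : ℝ) < (n.choose g : ℝ) := by exact_mod_cast Nat.choose_pos hgn
  rw [← mul_div_assoc, div_le_div_iff₀ c1 c2]
  have hprod : ∀ m : ℕ, g ≤ m →
      (g.factorial : ℝ) * (m.choose g : ℝ) = ∏ i ∈ Finset.range g, ((m : ℝ) - i) := by
    intro m hm
    rw [← Nat.cast_mul, ← Nat.descFactorial_eq_factorial_mul_choose,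
      Nat.descFactorial_eq_prod_range, Nat.cast_prod]
    refine Finset.prod_congr rfl fun i hi => ?_
    rw [Nat.cast_sub (by have := Finset.mem_range.1 hi; omega)]
  have hexp : Real.exp (ε ^ 2 * D) ≤ ∏ i ∈ Finset.range g, Real.exp (ε * D / υ) := by
    rw [Finset.prod_const, Finset.card_range, ← Real.exp_nat_mul, Real.exp_le_exp]
    have : ε * υ ≤ g := by rw [hg]; exact Nat.le_ceil _
    calc ε ^ 2 * D = (ε * υ) * (ε * D / υ) := by field_simp
      _ ≤ _ := by gcongr
  have hf : (0 : ℝ) < (g.factorial : ℝ) := by positivity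
  have main : (∏ i ∈ Finset.range g, Real.exp (ε * D / υ)) *
      ((g.factorial : ℝ) * ((υ - D).choose g : ℝ)) * ((g.factorial : ℝ) * (n.choose g : ℝ))
      ≤ ((g.factorial : ℝ) * (b.choose g : ℝ)) * ((g.factorial : ℝ) * (υ.choose g : ℝ)) := by
    rw [hprod _ (by omega : g ≤ υ - D), hprod n hgn, hprod b hgb, hprod υ (by omega),
      ← Finset.prod_mul_distrib, ← Finset.prod_mul_distrib, ← Finset.prod_mul_distrib]
    refine Finset.prod_le_prod (fun i hi => ?_) (fun i hi => ?_)
    · have hi' := Finset.mem_range.1 hi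
      have a1 : (i : ℝ) ≤ ((υ - D : ℕ) : ℝ) := by exact_mod_cast (by omega)
      have a2 : (i : ℝ) ≤ (n : ℝ) := by exact_mod_cast (by omega)
      exact mul_nonneg (mul_nonneg (Real.exp_pos _).le (by linarith)) (by linarith)
    · have hi' : (i : ℝ) < ε * υ := by
        rw [← Nat.lt_ceil, ← hg]; exact Finset.mem_range.1 hi
      have := urn_factor υ D n r i ε hDr hυr hnr hr0 hε hcross (by positivity) hi'
      rw [Nat.cast_sub hDυ, hbr]
      linarith
  have m2 : (g.factorial : ℝ) ^ 2 * ((∏ i ∈ Finset.range g, Real.exp (ε * D / υ)) *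
      ((υ - D).choose g : ℝ) * (n.choose g : ℝ)) ≤
      (g.factorial : ℝ) ^ 2 * ((b.choose g : ℝ) * (υ.choose g : ℝ)) := by
    linarith
  have m3 := le_of_mul_le_mul_left m2 (by positivity)
  refine le_trans ?_ m3
  gcongr

lemma urn_one_sided (υ : ℕ) (hυ : 1 ≤ υ) (A : Finset (Fin υ)) (ε : ℝ) (hε : 0 < ε) :
    ((Finset.univ.filter (fun π : Equiv.Perm (Fin υ) => urnCross A (ε * A.card) υ π)).card : ℝ)
      ≤ Real.exp (-(ε ^ 2 * A.card)) * (Fintype.card (Equiv.Perm (Fin υ))) := by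
  by_cases hE : ∃ π, urnCross A (ε * A.card) υ π
  swap
  · push Not at hE
    rw [Finset.filter_false_of_mem (fun π _ => hE π)]
    simp; positivity
  have hDυ : A.card ≤ υ := by simpa using Finset.card_le_univ A
  have hυ0 : (0 : ℝ) < υ := by exact_mod_cast hυ
  set g := ⌈ε * υ⌉₊ with hg
  have hcr : ∀ j ≤ υ, ∀ π, ε * A.card < (urnL A j π : ℝ) - j * A.card / υ →
      g ≤ υ - A.card ∧ Real.exp (ε ^ 2 * A.card) *
        (((υ - A.card).choose g : ℝ) / (υ.choose g : ℝ)) ≤ urnZ A g j π := by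
    intro j hj π h
    have h1 := urn_L_add_R A j π
    have h2 := urn_R_add_B A j π
    have hbD : urnB A j π + A.card ≤ υ := by
      have h3 : urnB A j π ≤ urnB A 0 π := by
        unfold urnB
        apply Finset.card_le_card
        intro i
        simp only [Finset.mem_filter, Finset.mem_univ, true_and, zero_le]
        tauto
      have h4 := urn_L_add_R A 0 π
      have h5 := urn_R_add_B A 0 π
      have h6 : urnL A 0 π = 0 := by simp [urnL]
      omega
    have hD : 0 < A.card := by
      rcases Nat.eq_zero_or_pos A.card with h0 | h0
      · have : urnL A j π = 0 := by omega
        rw [h0, this] at h; simp at h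
      · exact h0
    have := urn_numeric υ A.card (υ - j) (urnR A j π) (urnB A j π) g ε hD hDυ (by omega) hε h2
      hbD hg (by
        have e : (urnL A j π : ℝ) + urnR A j π = A.card := by exact_mod_cast h1
        rw [Nat.cast_sub hj]
        have e2 : (A.card : ℝ) * (((υ : ℝ) - j) / υ - ε)
          = A.card - j * A.card / υ - ε * A.card := by field_simp
        rw [e2]; linarith)
    exact ⟨by omega, this.2⟩
  set c := Real.exp (ε ^ 2 * A.card) * (((υ - A.card).choose g : ℝ) / (υ.choose g : ℝ)) with hc
  have hopt := urn_optional A g (ε * A.card) c (by positivity)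
    (fun j hj π h => (hcr j hj π h).2) υ le_rfl
  obtain ⟨π₀, j₀, hj₀, h₀⟩ := hE
  have hgD := (hcr j₀ hj₀ π₀ h₀).1
  have hZ0 : ∀ π, urnZ A g 0 π = ((υ - A.card).choose g : ℝ) / (υ.choose g : ℝ) := by
    intro π
    have h4 := urn_L_add_R A 0 π
    have h5 := urn_R_add_B A 0 π
    have h6 : urnL A 0 π = 0 := by simp [urnL]
    have : urnB A 0 π = υ - A.card := by omega
    rw [urnZ, this, Nat.sub_zero]
  simp only [hZ0, Finset.sum_const, nsmul_eq_mul, Finset.card_univ] at hopt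
  have hlow : ((Finset.univ.filter
      (fun π : Equiv.Perm (Fin υ) => urnCross A (ε * A.card) υ π)).card : ℝ) * c
      ≤ ∑ π, (if urnCross A (ε * A.card) υ π then c else urnZ A g υ π) := by
    rw [← nsmul_eq_mul, ← Finset.sum_const, Finset.sum_filter]
    refine Finset.sum_le_sum fun π _ => ?_
    split_ifs
    · exact le_rfl
    · exact urnZ_nonneg _ _ _ _
  have hq : (0 : ℝ) < ((υ - A.card).choose g : ℝ) / (υ.choose g : ℝ) := by
    have a1 : (0 : ℝ) < ((υ - A.card).choose g : ℝ) := by exact_mod_cast Nat.choose_pos hgD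
    have a2 : (0 : ℝ) < (υ.choose g : ℝ) := by exact_mod_cast Nat.choose_pos (by omega)
    positivity
  have h7 := hlow.trans hopt
  rw [hc, ← mul_assoc] at h7
  have h8 := le_of_mul_le_mul_right h7 hq
  rw [Real.exp_neg, inv_mul_eq_div, le_div_iff₀ (Real.exp_pos _)]
  exact h8

lemma urnL_rev {υ : ℕ} (A : Finset (Fin υ)) (j : ℕ) (hj : j ≤ υ) (π : Equiv.Perm (Fin υ)) :
    urnL A (υ - j) (π * Fin.revPerm) + urnL A j π = A.card := by
  have h : urnL A (υ - j) (π * Fin.revPerm) = urnR A j π := by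
    unfold urnL urnR
    apply Finset.card_bij (fun i _ => Fin.rev i)
    · intro a ha
      simp only [Finset.mem_filter, Finset.mem_univ, true_and, Equiv.Perm.mul_apply,
        Fin.revPerm_apply, Fin.val_rev] at ha ⊢
      refine ⟨by omega, ha.2⟩
    · intro a _ b _ h; exact Fin.rev_injective h
    · intro b hb
      refine ⟨Fin.rev b, ?_, by simp⟩
      simp only [Finset.mem_filter, Finset.mem_univ, true_and, Equiv.Perm.mul_apply,
        Fin.revPerm_apply, Fin.val_rev, Fin.rev_rev] at hb ⊢
      refine ⟨by have := b.2; omega, hb.2⟩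
  have := urn_L_add_R A j π
  omega

/-- Sampling without replacement from an urn with `υ` balls of which `D` are labelled `A`
(the draw order is a uniform permutation `π`; `Λ j` is the number of `A`-balls among the
first `j` draws): for every `ε > 0`,
`P(max_{j ≤ υ} |Λ j - j D/υ| > ε D) ≤ 2 exp(-ε² D / (2 + 2ε/3))`. -/
theorem urn_maximal_concentration (υ D : ℕ) (hυ : 1 ≤ υ)
    (A : Finset (Fin υ)) (hA : A.card = D) (ε : ℝ) (hε : 0 < ε) :
    ((Finset.univ.filter (fun π : Equiv.Perm (Fin υ) =>
        ∃ j ≤ υ, ε * D <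
          |((Finset.univ.filter (fun i : Fin υ => (i : ℕ) < j ∧ π i ∈ A)).card : ℝ)
            - j * D / υ|)).card : ℝ) / (Fintype.card (Equiv.Perm (Fin υ)))
      ≤ 2 * Real.exp (-(ε ^ 2 * D) / (2 + 2 * ε / 3)) := by
  subst hA
  have hυ0 : (0 : ℝ) < υ := by exact_mod_cast hυ
  set S := Finset.univ.filter (fun π : Equiv.Perm (Fin υ) => urnCross A (ε * A.card) υ π) with hS
  have h1 := urn_one_sided υ hυ A ε hε
  rw [← hS] at h1
  have hN : (0 : ℝ) < (Fintype.card (Equiv.Perm (Fin υ)) : ℝ) := by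
    exact_mod_cast Fintype.card_pos
  rw [div_le_iff₀ hN]
  have hsub : (Finset.univ.filter (fun π : Equiv.Perm (Fin υ) =>
        ∃ j ≤ υ, ε * A.card <
          |((Finset.univ.filter (fun i : Fin υ => (i : ℕ) < j ∧ π i ∈ A)).card : ℝ)
            - j * A.card / υ|)) ⊆ S ∪ S.image (fun π => π * Fin.revPerm) := by
    intro π hπ
    obtain ⟨j, hj, h⟩ := (Finset.mem_filter.1 hπ).2
    change ε * A.card < |(urnL A j π : ℝ) - j * A.card / υ| at h
    rw [Finset.mem_union]
    rcases lt_abs.1 h with h | h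
    · left
      exact Finset.mem_filter.2 ⟨Finset.mem_univ _, j, hj, h⟩
    · right
      refine Finset.mem_image.2 ⟨π * Fin.revPerm, ?_, ?_⟩
      · refine Finset.mem_filter.2 ⟨Finset.mem_univ _, υ - j, by omega, ?_⟩
        have e : (urnL A (υ - j) (π * Fin.revPerm) : ℝ) + urnL A j π = A.card := by
          exact_mod_cast urnL_rev A j hj π
        have e2 : ((υ - j : ℕ) : ℝ) * A.card / υ = A.card - j * A.card / υ := by
          rw [Nat.cast_sub hj]; field_simp
        rw [e2]; linarith
      · ext i; simp [Equiv.Perm.mul_apply]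
  have hcard := (Finset.card_le_card hsub).trans (Finset.card_union_le _ _)
  have hcard2 := hcard.trans (Nat.add_le_add_left Finset.card_image_le _)
  have hexp : Real.exp (-(ε ^ 2 * A.card)) ≤
      Real.exp (-(ε ^ 2 * A.card) / (2 + 2 * ε / 3)) := by
    rw [Real.exp_le_exp, neg_div, neg_le_neg_iff]
    apply div_le_self (by positivity)
    linarith
  have h2 := mul_le_mul_of_nonneg_right hexp hN.le
  have h3 := (Nat.cast_le (α := ℝ)).2 hcard2
  push_cast at h3
  linarith
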